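/- arXiv:2312.01076 — 2 statements merged into one kernel-verified Lean document; each statement's English description precedes it below -/
import Mathlib

section
/- Fix β ∈ (0, 1/2], r ≥ 0, γ ∈ ℝ, and suppose ‖γx‖ > β for all nonzero x ∈ D_b*(r). Then for each positive integer k, the number of indices d ∈ {0, …, r} with ‖k·b^d·γ‖ ≤ β is strictly less than 3√k. -/
/-- Distance from a real number to the nearest integer. -/
noncomputable def nearestIntDist (y : ℝ) : ℝ := |y - round y|

/-- `x ∈ D_b*(r) = D_b(r) ∪ { b^d - b^c : 0 ≤ c < d ≤ r }`. -/
def InDbStarR (b r x : ℕ) : Prop :=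
  (∃ ξ : ℕ → ℕ, (∀ i, ξ i ≤ 1) ∧ x = ∑ j ∈ Finset.range (r + 1), ξ j * b ^ j) ∨
  (∃ c d : ℕ, c < d ∧ d ≤ r ∧ x = b ^ d - b ^ c)

open scoped Pointwise in
/-- In a finite abelian group generated by a symmetric set `A` containing `0`, a nonempty set `X`
with `X + A` not everything satisfies `|X + A| ≥ |X| + |A| / 2`. -/
theorem two_mul_card_add_card_le_of_add_ne_univ {G : Type*} [AddCommGroup G] [Fintype G]
    [DecidableEq G] {A : Finset G} (h0 : 0 ∈ A) (hneg : ∀ a ∈ A, -a ∈ A)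
    (hgen : AddSubgroup.closure (A : Set G) = ⊤) {X : Finset G} (hX : X.Nonempty)
    (hXA : X + A ≠ Finset.univ) : 2 * X.card + A.card ≤ 2 * (X + A).card := by
  classical
  have hsub : ∀ Y : Finset G, Y ⊆ Y + A := fun Y y hy =>
    Finset.mem_add.2 ⟨y, hy, 0, h0, add_zero y⟩
  have hcard : ∀ Y : Finset G, Y.card ≤ (Y + A).card := fun Y => Finset.card_le_card (hsub Y)
  set F : Finset (Finset G) :=
    Finset.univ.filter fun Y => Y.Nonempty ∧ Y + A ≠ Finset.univ with hF
  have hmemF : ∀ Y, Y ∈ F ↔ Y.Nonempty ∧ Y + A ≠ Finset.univ := fun Y => by simp [hF]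
  obtain ⟨Z, hZF, hZmin⟩ := F.exists_min_image (fun Y => (Y + A).card - Y.card)
    ⟨X, (hmemF X).2 ⟨hX, hXA⟩⟩
  set κ := (Z + A).card - Z.card with hκ
  obtain ⟨W, hWF, hWmin⟩ := (F.filter fun Y => (Y + A).card - Y.card = κ).exists_min_image
    (fun Y => Y.card) ⟨Z, by simp [hZF, hκ]⟩
  obtain ⟨hWF, hWκ⟩ := Finset.mem_filter.1 hWF
  obtain ⟨⟨w, hw⟩, hWA⟩ := (hmemF W).1 hWF
  have hWc := hcard W
  -- the complement of `W + A` is another extremal set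
  have hdual : 2 * W.card + κ ≤ Fintype.card G := by
    set V := (W + A)ᶜ with hV
    have hVW : V + A ⊆ Wᶜ := by
      intro y hy
      obtain ⟨v, hv, a, ha, rfl⟩ := Finset.mem_add.1 hy
      rw [Finset.mem_compl]
      intro h
      rw [hV, Finset.mem_compl] at hv
      exact hv (Finset.mem_add.2 ⟨v + a, h, -a, hneg a ha, by abel⟩)
    have hVF : V ∈ F := by
      rw [hmemF]
      refine ⟨?_, fun h => ?_⟩
      · rw [Finset.nonempty_iff_ne_empty]
        intro h
        exact hWA ((Finset.compl_eq_empty_iff _).1 h)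
      · have := hVW (h ▸ Finset.mem_univ w)
        exact (Finset.mem_compl.1 this) hw
    have h1 := hZmin V hVF
    have h2 := Finset.card_le_card hVW
    have h3 := hcard V
    have h4 : V.card = Fintype.card G - (W + A).card := Finset.card_compl _
    have h5 : (Wᶜ : Finset G).card = Fintype.card G - W.card := Finset.card_compl _
    have h6 := Finset.card_le_univ (W + A)
    have h7 : (V + A).card - V.card = κ := by omega
    have h8 := hWmin V (Finset.mem_filter.2 ⟨hVF, h7⟩)
    omega
  have htrans : ∀ g : G, (∃ x ∈ W, x + g ∈ W) → ∀ x ∈ W, x + g ∈ W := by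
    rintro g ⟨x₀, hx₀, hx₀g⟩
    set Y := W.image (· + g) with hY
    have hYc : Y.card = W.card := Finset.card_image_of_injective _ (add_left_injective g)
    have hYA : Y + A = (W + A).image (· + g) := by
      ext y
      simp only [hY, Finset.mem_add, Finset.mem_image]
      constructor
      · rintro ⟨_, ⟨x, hx, rfl⟩, a, ha, rfl⟩
        exact ⟨x + a, ⟨x, hx, a, ha, rfl⟩, by abel⟩
      · rintro ⟨_, ⟨x, hx, a, ha, rfl⟩, rfl⟩
        exact ⟨x + g, ⟨x, hx, rfl⟩, a, ha, by abel⟩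
    have hYAc : (Y + A).card = (W + A).card := by
      rw [hYA]; exact Finset.card_image_of_injective _ (add_left_injective g)
    by_contra! hcon
    obtain ⟨x₁, hx₁, hx₁g⟩ := hcon
    have hI : (W ∩ Y).Nonempty :=
      ⟨x₀ + g, Finset.mem_inter.2 ⟨hx₀g, Finset.mem_image.2 ⟨x₀, hx₀, rfl⟩⟩⟩
    have hIF : W ∩ Y ∈ F := by
      rw [hmemF]
      refine ⟨hI, fun h => hWA ?_⟩
      rw [← Finset.univ_subset_iff, ← h]
      exact Finset.add_subset_add_right Finset.inter_subset_left
    have hIlt : (W ∩ Y).card < W.card := by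
      rw [← hYc]
      refine Finset.card_lt_card ⟨Finset.inter_subset_right, fun h => hx₁g ?_⟩
      exact (Finset.mem_inter.1 (h (Finset.mem_image.2 ⟨x₁, hx₁, rfl⟩))).1
    have hIκ : κ < (W ∩ Y + A).card - (W ∩ Y).card := by
      refine lt_of_le_of_ne (hZmin _ hIF) fun h => ?_
      have := hWmin _ (Finset.mem_filter.2 ⟨hIF, h.symm⟩)
      omega
    have h1 : (W ∩ Y + A).card ≤ ((W + A) ∩ (Y + A)).card :=
      Finset.card_le_card (Finset.subset_inter
        (Finset.add_subset_add_right Finset.inter_subset_left)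
        (Finset.add_subset_add_right Finset.inter_subset_right))
    have h2 : W ∪ Y + A = (W + A) ∪ (Y + A) := Finset.union_add
    have h3 := Finset.card_union_add_card_inter (W + A) (Y + A)
    have h4 := Finset.card_union_add_card_inter W Y
    have h5 := hcard (W ∪ Y)
    rw [← h2] at h3
    have hUU : W ∪ Y + A = Finset.univ := by
      by_contra h
      have := hZmin (W ∪ Y)
        ((hmemF _).2 ⟨⟨w, Finset.mem_union_left _ hw⟩, h⟩)
      omega
    have h6 : (W ∪ Y + A).card = Fintype.card G := by rw [hUU]; rfl
    have h7 := Finset.card_pos.2 hI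
    omega
  -- so `W` is a coset of a subgroup
  let H : AddSubgroup G :=
    { carrier := {g | w + g ∈ W}
      zero_mem' := by simpa using hw
      add_mem' := by
        intro a b ha hb
        have := htrans b ⟨w, hw, hb⟩ (w + a) ha
        simpa [add_assoc] using this
      neg_mem' := by
        intro a ha
        exact htrans (-a) ⟨w + a, ha, by simpa using hw⟩ w hw }
  have hAH : ∃ a ∈ A, a ∉ H := by
    by_contra! hcon
    have hH : H = ⊤ := by
      rw [eq_top_iff, ← hgen, AddSubgroup.closure_le]
      exact hcon
    apply hWA
    rw [← Finset.univ_subset_iff]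
    intro y _
    refine hsub W ?_
    have : y - w ∈ H := hH ▸ AddSubgroup.mem_top _
    have h' : w + (y - w) ∈ W := this
    simpa using h'
  obtain ⟨a, haA, haH⟩ := hAH
  have hdisj : Disjoint W (W.image (· + a)) := by
    rw [Finset.disjoint_left]
    intro y hy hy'
    obtain ⟨x, hx, rfl⟩ := Finset.mem_image.1 hy'
    exact haH (htrans a ⟨x, hx, hy⟩ w hw)
  have h2W : 2 * W.card ≤ (W + A).card := by
    rw [two_mul]
    nth_rw 2 [← Finset.card_image_of_injective W (add_left_injective a)]
    rw [← Finset.card_union_of_disjoint hdisj]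
    refine Finset.card_le_card (Finset.union_subset (hsub W) fun y hy => ?_)
    obtain ⟨x, hx, rfl⟩ := Finset.mem_image.1 hy
    exact Finset.mem_add.2 ⟨x, hx, a, haA, rfl⟩
  have hA : A.card ≤ (W + A).card := Finset.card_le_card_add_left ⟨w, hw⟩
  have := hZmin X ((hmemF X).2 ⟨hX, hXA⟩)
  have := hcard X
  omega

/-- The number of elements of `B` that translation by `x` moves out of `B`. -/
def escapeCard {G : Type*} [AddCommGroup G] [DecidableEq G] (B : Finset G) (x : G) : ℕ :=
  (B.filter fun c => c + x ∉ B).card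

theorem escapeCard_zero {G : Type*} [AddCommGroup G] [DecidableEq G] (B : Finset G) :
    escapeCard B 0 = 0 := by
  simp [escapeCard]

theorem escapeCard_add_le {G : Type*} [AddCommGroup G] [DecidableEq G] (B : Finset G) (x y : G) :
    escapeCard B (x + y) ≤ escapeCard B x + escapeCard B y := by
  unfold escapeCard
  rw [← Finset.card_image_of_injective (B.filter fun c => c + y ∉ B)
    (add_left_injective (-x))]
  refine (Finset.card_le_card fun c hc => ?_).trans (Finset.card_union_le _ _)
  rw [Finset.mem_filter] at hc
  simp only [Finset.mem_union, Finset.mem_filter, Finset.mem_image]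
  by_cases h : c + x ∈ B
  · exact Or.inr ⟨c + x, ⟨h, by rw [add_assoc]; exact hc.2⟩, by abel⟩
  · exact Or.inl ⟨hc.1, h⟩

theorem escapeCard_neg {G : Type*} [AddCommGroup G] [DecidableEq G] (B : Finset G) (x : G) :
    escapeCard B (-x) = escapeCard B x := by
  unfold escapeCard
  have h1 := Finset.card_filter_add_card_filter_not (s := B) (fun c => c + x ∈ B)
  have h2 := Finset.card_filter_add_card_filter_not (s := B) (fun c => c + -x ∈ B)
  have h3 : (B.filter fun c => c + x ∈ B).card = (B.filter fun c => c + -x ∈ B).card := by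
    refine Finset.card_bij (fun c _ => c + x) ?_ ?_ ?_
    · intro c hc
      simpa [and_comm] using hc
    · intro c _ d _ h
      simpa using h
    · intro c hc
      rw [Finset.mem_filter] at hc
      exact ⟨c + -x, by simpa [and_comm] using hc, by simp⟩
  omega

theorem escapeCard_compl {G : Type*} [AddCommGroup G] [Fintype G] [DecidableEq G]
    (B : Finset G) (x : G) : escapeCard Bᶜ x = escapeCard B x := by
  rw [← escapeCard_neg B]
  unfold escapeCard
  refine Finset.card_bij (fun c _ => c + x) ?_ ?_ ?_
  · intro c hc
    simpa [and_comm] using hc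
  · intro c _ d _ h
    simpa using h
  · intro c hc
    rw [Finset.mem_filter] at hc
    exact ⟨c + -x, by simpa [and_comm] using hc, by simp⟩

theorem card_mul_card_le_sum_escapeCard {G : Type*} [AddCommGroup G] [DecidableEq G]
    (B Y : Finset G) :
    Y.card * B.card ≤ ∑ y ∈ Y, escapeCard B y + B.card * B.card := by
  have h : ∀ y, B.card = escapeCard B y + (B.filter fun c => c + y ∈ B).card := fun y => by
    rw [add_comm, escapeCard]
    exact (Finset.card_filter_add_card_filter_not _).symm
  have hsum : Y.card * B.card
      = ∑ y ∈ Y, escapeCard B y + ∑ y ∈ Y, (B.filter fun c => c + y ∈ B).card := by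
    rw [← Finset.sum_add_distrib, ← smul_eq_mul, ← Finset.sum_const]
    exact Finset.sum_congr rfl fun y _ => h y
  rw [hsum]
  gcongr
  simp only [Finset.card_filter]
  rw [Finset.sum_comm, ← smul_eq_mul, ← Finset.sum_const]
  refine Finset.sum_le_sum fun c _ => ?_
  rw [← Finset.card_filter]
  refine Finset.card_le_card_of_injOn (c + ·) ?_ (add_right_injective c).injOn
  intro y hy
  exact (Finset.mem_filter.1 hy).2

open scoped Pointwise in
/-- The ball of radius `j` in the Cayley graph of `A`. -/
def cayleyBall {G : Type*} [AddCommGroup G] [DecidableEq G] (A : Finset G) : ℕ → Finset G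
  | 0 => {0}
  | j + 1 => cayleyBall A j + A

theorem cayleyBall_mono {G : Type*} [AddCommGroup G] [DecidableEq G] {A : Finset G}
    (h0 : 0 ∈ A) : Monotone (cayleyBall A) := by
  refine monotone_nat_of_le_succ fun j y hy => ?_
  exact Finset.mem_add.2 ⟨y, hy, 0, h0, add_zero y⟩

theorem zero_mem_cayleyBall {G : Type*} [AddCommGroup G] [DecidableEq G] {A : Finset G}
    (h0 : 0 ∈ A) (j : ℕ) : 0 ∈ cayleyBall A j :=
  cayleyBall_mono h0 (Nat.zero_le j) (Finset.mem_singleton_self 0)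

theorem cayleyBall_eq_univ_or_le_card {G : Type*} [AddCommGroup G] [Fintype G] [DecidableEq G]
    {A : Finset G} (h0 : 0 ∈ A) (hneg : ∀ a ∈ A, -a ∈ A)
    (hgen : AddSubgroup.closure (A : Set G) = ⊤) (j : ℕ) :
    cayleyBall A (j + 1) = Finset.univ ∨
      (j + 2) * A.card ≤ 2 * (cayleyBall A (j + 1)).card := by
  induction j with
  | zero => right; simp [cayleyBall]
  | succ j ih =>
    by_cases h : cayleyBall A (j + 1 + 1) = Finset.univ
    · exact Or.inl h
    right
    rcases ih with ih | ih
    · refine absurd ?_ h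
      rw [← Finset.univ_subset_iff, ← ih]
      exact cayleyBall_mono h0 (Nat.le_succ _)
    · have := two_mul_card_add_card_le_of_add_ne_univ h0 hneg hgen
        ⟨0, zero_mem_cayleyBall h0 (j + 1)⟩ h
      change _ ≤ 2 * (cayleyBall A (j + 1 + 1)).card at this
      linarith

theorem escapeCard_le_mul_of_mem_cayleyBall {G : Type*} [AddCommGroup G] [DecidableEq G]
    {A B : Finset G} {M : ℕ} (hM : ∀ a ∈ A, escapeCard B a ≤ M) (j : ℕ) :
    ∀ y ∈ cayleyBall A j, escapeCard B y ≤ j * M := by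
  induction j with
  | zero =>
    intro y hy
    rw [Finset.mem_singleton.1 hy, escapeCard_zero]
    exact Nat.zero_le _
  | succ j ih =>
    intro y hy
    obtain ⟨z, hz, a, ha, rfl⟩ := Finset.mem_add.1 hy
    have h1 := escapeCard_add_le B z a
    have h2 := ih z hz
    have h3 := hM a ha
    linarith

/-- Olson's lemma: if a symmetric generating set `A` containing `0` moves at most `M` points out of
a set `B` of at most half the group, then `M` is at least about `min (|B| / 2) (|A| / 4)`. -/
theorem olson_lemma_of_symmetric {G : Type*} [AddCommGroup G] [Fintype G] [DecidableEq G]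
    {A B : Finset G} {M : ℕ} (h0 : 0 ∈ A) (hneg : ∀ a ∈ A, -a ∈ A)
    (hgen : AddSubgroup.closure (A : Set G) = ⊤) (hB : B.Nonempty)
    (hBG : 2 * B.card ≤ Fintype.card G) (hM : ∀ a ∈ A, escapeCard B a ≤ M) :
    B.card + 1 ≤ 2 * M ∨ A.card + 1 ≤ 4 * M := by
  have hb : 0 < B.card := Finset.card_pos.2 hB
  have hA : 0 < A.card := Finset.card_pos.2 ⟨0, h0⟩
  have hex : ∃ j, 2 * B.card ≤ (cayleyBall A j).card := by
    rcases cayleyBall_eq_univ_or_le_card h0 hneg hgen (4 * B.card) with h | h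
    · exact ⟨_, by rw [h, Finset.card_univ]; exact hBG⟩
    · refine ⟨_, le_of_mul_le_mul_left (h.trans' ?_) (Nat.zero_lt_two)⟩
      nlinarith
  obtain ⟨J, hJ, hJmin⟩ : ∃ J, 2 * B.card ≤ (cayleyBall A (J + 1)).card ∧
      ∀ j ≤ J, (cayleyBall A j).card < 2 * B.card := by
    have hspec := Nat.find_spec hex
    have hmin := fun j (hj : j < Nat.find hex) => not_le.1 (Nat.find_min hex hj)
    cases hn : Nat.find hex with
    | zero =>
      rw [hn] at hspec
      simp only [cayleyBall, Finset.card_singleton] at hspec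
      omega
    | succ J =>
      rw [hn] at hspec
      exact ⟨J, hspec, fun j hj => hmin j (by omega)⟩
  obtain ⟨Y, hY1, hY2, hYc⟩ := Finset.exists_subsuperset_card_eq
    (cayleyBall_mono h0 (Nat.le_succ J)) (hJmin J le_rfl).le hJ
  have hpt : ∀ y ∈ Y, escapeCard B y
      ≤ ((Finset.range (J + 1)).filter fun j => y ∉ cayleyBall A j).card * M := by
    intro y hy
    have hyex : ∃ i, y ∈ cayleyBall A i := ⟨_, hY2 hy⟩
    refine (escapeCard_le_mul_of_mem_cayleyBall hM _ y (Nat.find_spec hyex)).trans ?_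
    gcongr
    rw [← Finset.card_range (Nat.find hyex)]
    refine Finset.card_le_card fun i hi => ?_
    have hi := Finset.mem_range.1 hi
    have := Nat.find_min' hyex (hY2 hy)
    exact Finset.mem_filter.2 ⟨Finset.mem_range.2 (by omega), Nat.find_min hyex hi⟩
  have hlev : ∑ y ∈ Y, ((Finset.range (J + 1)).filter fun j => y ∉ cayleyBall A j).card
      = ∑ j ∈ Finset.range (J + 1), (2 * B.card - (cayleyBall A j).card) := by
    simp only [Finset.card_filter]
    rw [Finset.sum_comm]
    refine Finset.sum_congr rfl fun j hj => ?_
    rw [← Finset.card_filter, ← hYc, ← Finset.card_sdiff_of_subset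
      ((cayleyBall_mono h0 (Nat.lt_succ_iff.1 (Finset.mem_range.1 hj))).trans hY1)]
    congr 1
    ext y
    simp
  have hbb : B.card * B.card
      ≤ (∑ j ∈ Finset.range (J + 1), (2 * B.card - (cayleyBall A j).card)) * M := by
    have h1 := card_mul_card_le_sum_escapeCard B Y
    have h2 := Finset.sum_le_sum hpt
    rw [← Finset.sum_mul, hlev] at h2
    rw [hYc] at h1
    linarith
  -- the levels between `1` and `J` contribute an arithmetic progression
  have hprog : ∀ q ≤ J,
      4 * ∑ j ∈ Finset.range (q + 1), ((2 * B.card - (cayleyBall A j).card : ℕ) : ℤ)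
        + A.card * (q * (q + 3)) ≤ 8 * B.card * (q + 1) - 4 := by
    intro q hq
    induction q with
    | zero =>
      have := hJmin 0 (Nat.zero_le J)
      simp [cayleyBall]
      omega
    | succ q ih =>
      have ih := ih (by omega)
      have h1 := hJmin (q + 1) hq
      have h2 : (q + 2) * A.card ≤ 2 * (cayleyBall A (q + 1)).card := by
        refine (cayleyBall_eq_univ_or_le_card h0 hneg hgen q).resolve_left fun h => ?_
        rw [h, Finset.card_univ] at h1
        omega
      rw [Finset.sum_range_succ]
      zify [h1.le] at h2 ⊢
      nlinarith
  have hL := hprog J le_rfl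
  zify at hbb
  set L := ∑ j ∈ Finset.range (J + 1), ((2 * B.card - (cayleyBall A j).card : ℕ) : ℤ) with hLdef
  by_contra! hcon
  obtain ⟨hc1, hc2⟩ := hcon
  zify at hc1 hc2 hb hA
  rcases Nat.eq_zero_or_pos J with rfl | hJ0
  · push_cast at hL
    have : (M : ℤ) * L ≤ M * (2 * B.card - 1) := by
      apply mul_le_mul_of_nonneg_left <;> omega
    nlinarith
  · have hJ1 : (1 : ℤ) ≤ J := by exact_mod_cast hJ0
    have hM4 : 4 * (M : ℤ) ≤ A.card := by omega
    have hLnn : 0 ≤ L := Finset.sum_nonneg fun _ _ => by positivity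
    have h1 : 4 * (M : ℤ) * L ≤ A.card * L := mul_le_mul_of_nonneg_right hM4 hLnn
    have h2 : (A.card : ℤ) * (4 * L) ≤
        A.card * (8 * B.card * (J + 1) - 4 - A.card * (J * (J + 3))) :=
      mul_le_mul_of_nonneg_left (by linarith) hA.le
    have h3 : 0 ≤ (A.card : ℤ) ^ 2 * (J - 1) := mul_nonneg (sq_nonneg _) (by linarith)
    nlinarith [sq_nonneg (4 * (B.card : ℤ) - A.card * (J + 1))]

/-- The set of all subset sums of `S`, including the empty sum. -/
def subsetSums {G : Type*} [AddCommGroup G] [DecidableEq G] (S : Finset G) : Finset G :=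
  S.powerset.image fun T => ∑ x ∈ T, x

/-- No nonempty subset of `S` sums to zero. -/
def ZeroSumFree {G : Type*} [AddCommGroup G] (S : Finset G) : Prop :=
  ∀ T ⊆ S, T.Nonempty → ∑ x ∈ T, x ≠ 0

theorem mem_subsetSums {G : Type*} [AddCommGroup G] [DecidableEq G] {S : Finset G} {y : G} :
    y ∈ subsetSums S ↔ ∃ T ⊆ S, ∑ x ∈ T, x = y := by
  simp [subsetSums]

theorem zero_mem_subsetSums {G : Type*} [AddCommGroup G] [DecidableEq G] (S : Finset G) :
    0 ∈ subsetSums S :=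
  mem_subsetSums.2 ⟨∅, Finset.empty_subset S, Finset.sum_empty⟩

theorem ZeroSumFree.mono {G : Type*} [AddCommGroup G] {S T : Finset G} (hS : ZeroSumFree S)
    (hT : T ⊆ S) : ZeroSumFree T :=
  fun U hU hne => hS U (hU.trans hT) hne

theorem ZeroSumFree.zero_notMem {G : Type*} [AddCommGroup G] {S : Finset G}
    (hS : ZeroSumFree S) : 0 ∉ S := fun h =>
  hS {0} (Finset.singleton_subset_iff.2 h) (Finset.singleton_nonempty 0) (Finset.sum_singleton _ _)

theorem ZeroSumFree.eq_neg_of_neg_mem {G : Type*} [AddCommGroup G] [DecidableEq G]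
    {S : Finset G} (hS : ZeroSumFree S) {x : G} (hx : x ∈ S) (hx' : -x ∈ S) : x = -x := by
  by_contra hne
  refine hS {x, -x} ?_ ⟨x, by simp⟩ (by rw [Finset.sum_pair hne, add_neg_cancel])
  intro y hy
  rcases Finset.mem_insert.1 hy with rfl | hy
  · exact hx
  · rwa [Finset.mem_singleton.1 hy]

theorem card_subsetSums_insert {G : Type*} [AddCommGroup G] [DecidableEq G] {T : Finset G} {x : G}
    (hx : x ∉ T) : (subsetSums (insert x T)).card
      = (subsetSums T).card + escapeCard (subsetSums T) x := by
  have h : subsetSums (insert x T)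
      = subsetSums T ∪ ((subsetSums T).filter fun c => c + x ∉ subsetSums T).image (· + x) := by
    ext y
    simp only [Finset.mem_union, Finset.mem_image, Finset.mem_filter]
    constructor
    · intro hy
      obtain ⟨U, hU, rfl⟩ := mem_subsetSums.1 hy
      by_cases hxU : x ∈ U
      · have h1 : ∑ z ∈ U.erase x, z ∈ subsetSums T :=
          mem_subsetSums.2 ⟨U.erase x, by rwa [← Finset.subset_insert_iff], rfl⟩
        have h2 : ∑ z ∈ U.erase x, z + x = ∑ z ∈ U, z := Finset.sum_erase_add U (fun z => z) hxU
        by_cases h3 : ∑ z ∈ U, z ∈ subsetSums T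
        · exact Or.inl h3
        · exact Or.inr ⟨_, ⟨h1, by rwa [h2]⟩, h2⟩
      · exact Or.inl (mem_subsetSums.2 ⟨U, (Finset.subset_insert_iff_of_notMem hxU).1 hU, rfl⟩)
    · rintro (hy | ⟨c, ⟨hc, -⟩, rfl⟩)
      · obtain ⟨U, hU, rfl⟩ := mem_subsetSums.1 hy
        exact mem_subsetSums.2 ⟨U, hU.trans (Finset.subset_insert x T), rfl⟩
      · obtain ⟨U, hU, rfl⟩ := mem_subsetSums.1 hc
        refine mem_subsetSums.2 ⟨insert x U, Finset.insert_subset_insert x hU, ?_⟩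
        rw [Finset.sum_insert fun h => hx (hU h), add_comm]
  rw [h, Finset.card_union_of_disjoint, Finset.card_image_of_injective _ (add_left_injective x),
    escapeCard]
  rw [Finset.disjoint_left]
  rintro y hy hy'
  obtain ⟨c, hc, rfl⟩ := Finset.mem_image.1 hy'
  exact (Finset.mem_filter.1 hc).2 hy

theorem ZeroSumFree.card_lt_card_subsetSums {G : Type*} [AddCommGroup G] [DecidableEq G]
    {S : Finset G} (hS : ZeroSumFree S) : S.card < (subsetSums S).card := by
  rw [← Nat.succ_le_iff, Nat.succ_eq_add_one, ← Finset.card_insert_of_notMem hS.zero_notMem]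
  refine Finset.card_le_card (Finset.insert_subset (zero_mem_subsetSums S) fun x hx => ?_)
  exact mem_subsetSums.2 ⟨{x}, Finset.singleton_subset_iff.2 hx, Finset.sum_singleton _ _⟩

theorem ZeroSumFree.card_subsetSums_add_card_subsetSums_sdiff_le {G : Type*} [AddCommGroup G]
    [DecidableEq G] {S T : Finset G} (hS : ZeroSumFree S) (hT : T ⊆ S) :
    (subsetSums T).card + (subsetSums (S \ T)).card ≤ (subsetSums S).card + 1 := by
  set R := S \ T with hR
  have hTR : Disjoint T R := Finset.disjoint_sdiff
  have hRS : R ⊆ S := Finset.sdiff_subset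
  set σ := ∑ x ∈ R, x with hσ
  set X := (subsetSums T).image (· + σ) with hX
  have hXc : X.card = (subsetSums T).card :=
    Finset.card_image_of_injective _ (add_left_injective σ)
  have hunion : X ∪ subsetSums R ⊆ subsetSums S := by
    refine Finset.union_subset (fun y hy => ?_) fun y hy => ?_
    · obtain ⟨c, hc, rfl⟩ := Finset.mem_image.1 hy
      obtain ⟨U, hU, rfl⟩ := mem_subsetSums.1 hc
      exact mem_subsetSums.2 ⟨U ∪ R, Finset.union_subset (hU.trans hT) hRS,
        Finset.sum_union (hTR.mono_left hU)⟩
    · obtain ⟨U, hU, rfl⟩ := mem_subsetSums.1 hy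
      exact mem_subsetSums.2 ⟨U, hU.trans hRS, rfl⟩
  have hinter : X ∩ subsetSums R ⊆ {σ} := by
    intro y hy
    obtain ⟨hyX, hyR⟩ := Finset.mem_inter.1 hy
    obtain ⟨c, hc, rfl⟩ := Finset.mem_image.1 hyX
    obtain ⟨U, hU, rfl⟩ := mem_subsetSums.1 hc
    obtain ⟨V, hV, hVeq⟩ := mem_subsetSums.1 hyR
    have hsum : ∑ x ∈ U ∪ R \ V, x = 0 := by
      rw [Finset.sum_union (hTR.mono hU Finset.sdiff_subset)]
      have h1 : ∑ x ∈ R \ V, x + ∑ x ∈ V, x = σ := Finset.sum_sdiff hV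
      rw [hVeq] at h1
      have h2 : ∑ x ∈ R \ V, x + ∑ x ∈ U, x + σ = 0 + σ := by rw [add_assoc, h1, zero_add]
      rw [add_comm]
      exact add_right_cancel h2
    have hemp : U ∪ R \ V = ∅ := by
      by_contra hne
      exact hS _ (Finset.union_subset (hU.trans hT) (Finset.sdiff_subset.trans hRS))
        (Finset.nonempty_iff_ne_empty.2 hne) hsum
    rw [(Finset.union_eq_empty.1 hemp).1]
    simp
  have h1 := Finset.card_le_card hunion
  have h2 := Finset.card_le_card hinter
  have h3 := Finset.card_union_add_card_inter X (subsetSums R)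
  rw [Finset.card_singleton] at h2
  omega

theorem two_mul_card_subsetSums_le_of_notMem_closure {G : Type*} [AddCommGroup G] [DecidableEq G]
    {S R : Finset G} (hR : R ⊆ S) {x : G} (hx : x ∈ S)
    (hxR : x ∉ AddSubgroup.closure (R : Set G)) :
    2 * (subsetSums R).card ≤ (subsetSums S).card := by
  have hxR' : x ∉ R := fun h => hxR (AddSubgroup.subset_closure h)
  have hmem : ∀ y ∈ subsetSums R, y ∈ AddSubgroup.closure (R : Set G) := by
    intro y hy
    obtain ⟨U, hU, rfl⟩ := mem_subsetSums.1 hy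
    exact AddSubgroup.sum_mem _ fun z hz => AddSubgroup.subset_closure (hU hz)
  have hesc : escapeCard (subsetSums R) x = (subsetSums R).card := by
    unfold escapeCard
    rw [Finset.filter_true_of_mem]
    intro c hc hcx
    exact hxR ((AddSubgroup.add_mem_cancel_left _ (hmem c hc)).1 (hmem _ hcx))
  rw [two_mul]
  nth_rw 2 [← hesc]
  rw [← card_subsetSums_insert hxR']
  refine Finset.card_le_card fun y hy => ?_
  obtain ⟨U, hU, rfl⟩ := mem_subsetSums.1 hy
  exact mem_subsetSums.2 ⟨U, hU.trans (Finset.insert_subset hx hR), rfl⟩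

theorem subsetSums_image {G H : Type*} [AddCommGroup G] [AddCommGroup H] [DecidableEq G]
    [DecidableEq H] (f : H →+ G) (hf : Function.Injective f) (S : Finset H) :
    subsetSums (S.image f) = (subsetSums S).image f := by
  ext y
  simp only [Finset.mem_image, mem_subsetSums]
  constructor
  · rintro ⟨T, hT, rfl⟩
    obtain ⟨U, hU, rfl⟩ := Finset.subset_image_iff.1 hT
    refine ⟨_, ⟨U, hU, rfl⟩, ?_⟩
    rw [map_sum, Finset.sum_image hf.injOn]
  · rintro ⟨_, ⟨U, hU, rfl⟩, rfl⟩
    refine ⟨U.image f, Finset.image_subset_image hU, ?_⟩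
    rw [map_sum, Finset.sum_image hf.injOn]

theorem ZeroSumFree.of_image {G H : Type*} [AddCommGroup G] [AddCommGroup H] [DecidableEq G]
    (f : H →+ G) (hf : Function.Injective f) {S : Finset H} (hS : ZeroSumFree (S.image f)) :
    ZeroSumFree S := by
  intro T hT hne h
  refine hS (T.image f) (Finset.image_subset_image hT) (hne.image f) ?_
  rw [Finset.sum_image hf.injOn, ← map_sum, h, map_zero]

theorem ZeroSumFree.two_mul_card_le_card_insert_union_neg {G : Type*} [AddCommGroup G] [Fintype G]
    [DecidableEq G] [IsAddCyclic G] {R : Finset G} (hR : ZeroSumFree R) :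
    2 * R.card ≤ (insert 0 (R ∪ R.image (- ·))).card := by
  have h1 : 0 ∉ R ∪ R.image (- ·) := by
    intro h
    rcases Finset.mem_union.1 h with h | h
    · exact hR.zero_notMem h
    · obtain ⟨x, hx, hx0⟩ := Finset.mem_image.1 h
      rw [neg_eq_zero] at hx0
      exact hR.zero_notMem (hx0 ▸ hx)
  have h2 : (R.image (- ·)).card = R.card := Finset.card_image_of_injective _ neg_injective
  have h3 : (insert 0 (R ∩ R.image (- ·))).card ≤ 2 := by
    refine (Finset.card_le_card ?_).trans
      (IsAddCyclic.card_nsmul_eq_zero_le (α := G) (n := 2) Nat.zero_lt_two)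
    intro y hy
    rw [Finset.mem_filter]
    refine ⟨Finset.mem_univ y, ?_⟩
    rcases Finset.mem_insert.1 hy with rfl | hy
    · simp
    · obtain ⟨hyR, hyN⟩ := Finset.mem_inter.1 hy
      obtain ⟨x, hx, rfl⟩ := Finset.mem_image.1 hyN
      have := hR.eq_neg_of_neg_mem hx hyR
      rw [two_nsmul]
      nth_rw 1 [← this]
      exact add_neg_cancel x
  rw [Finset.card_insert_of_notMem fun h => h1 (Finset.mem_union_left _ (Finset.mem_inter.1 h).1)]
    at h3
  rw [Finset.card_insert_of_notMem h1]
  have h4 := Finset.card_union_add_card_inter R (R.image (- ·))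
  omega

theorem ZeroSumFree.exists_escapeCard_ge {G : Type*} [AddCommGroup G] [Fintype G]
    [DecidableEq G] [IsAddCyclic G] {R B : Finset G} (hR : ZeroSumFree R) (hRne : R.Nonempty)
    (hgen : AddSubgroup.closure (R : Set G) = ⊤) (hB : B.Nonempty)
    (hBR : B.card + R.card ≤ Fintype.card G) :
    ∃ x ∈ R, min B.card R.card + 1 ≤ 2 * escapeCard B x := by
  obtain ⟨x, hx, hmax⟩ := R.exists_max_image (escapeCard B) hRne
  refine ⟨x, hx, ?_⟩
  set A := insert 0 (R ∪ R.image (- ·)) with hA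
  have h2R : 2 * R.card ≤ A.card := hR.two_mul_card_le_card_insert_union_neg
  have h0 : 0 ∈ A := Finset.mem_insert_self _ _
  have hneg : ∀ a ∈ A, -a ∈ A := by
    intro a ha
    simp only [hA, Finset.mem_insert, Finset.mem_union, Finset.mem_image] at ha ⊢
    rcases ha with rfl | ha | ⟨z, hz, rfl⟩
    · simp
    · exact Or.inr (Or.inr ⟨a, ha, rfl⟩)
    · simp [hz]
  have hRA : R ⊆ A := Finset.subset_union_left.trans (Finset.subset_insert _ _)
  have hAgen : AddSubgroup.closure (A : Set G) = ⊤ :=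
    top_le_iff.1 (hgen ▸ AddSubgroup.closure_mono (Finset.coe_subset.2 hRA))
  have hM : ∀ a ∈ A, escapeCard B a ≤ escapeCard B x := by
    intro a ha
    simp only [hA, Finset.mem_insert, Finset.mem_union, Finset.mem_image] at ha
    rcases ha with rfl | ha | ⟨z, hz, rfl⟩
    · simp [escapeCard_zero]
    · exact hmax a ha
    · rw [escapeCard_neg]
      exact hmax z hz
  have hRpos := Finset.card_pos.2 hRne
  by_cases hhalf : 2 * B.card ≤ Fintype.card G
  · rcases olson_lemma_of_symmetric h0 hneg hAgen hB hhalf hM with h | h <;> omega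
  · have hc := Finset.card_compl B
    have hM' : ∀ a ∈ A, escapeCard Bᶜ a ≤ escapeCard B x := fun a ha => by
      rw [escapeCard_compl]
      exact hM a ha
    rcases olson_lemma_of_symmetric h0 hneg hAgen (Finset.card_pos.1 (by omega)) (by omega) hM'
      with h | h <;> omega

/-- Lower bounds for the successive numbers of subset sums, when elements are added one at a time
and at least `p` of them remain at each step. -/
def growthBound (p : ℕ) : ℕ → ℕ
  | 0 => 1
  | i + 1 => growthBound p i + (min (growthBound p i) p + 2) / 2

theorem ZeroSumFree.exists_subset_growthBound_le {G : Type*} [AddCommGroup G] [Fintype G]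
    [DecidableEq G] [IsAddCyclic G] {S : Finset G} (hS : ZeroSumFree S) {p : ℕ} (hp : 0 < p)
    (hgen : ∀ R ⊆ S, p ≤ R.card → AddSubgroup.closure (R : Set G) = ⊤) (i : ℕ)
    (hi : i + p ≤ S.card + 1) :
    ∃ T ⊆ S, T.card = i ∧ growthBound p i ≤ (subsetSums T).card := by
  induction i with
  | zero =>
    exact ⟨∅, Finset.empty_subset S, rfl, Finset.card_pos.2 ⟨0, zero_mem_subsetSums ∅⟩⟩
  | succ i ih =>
    obtain ⟨T, hTS, hTc, hT⟩ := ih (by omega)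
    have hRc : (S \ T).card = S.card - i := by rw [Finset.card_sdiff_of_subset hTS, hTc]
    have hRz : ZeroSumFree (S \ T) := hS.mono Finset.sdiff_subset
    have h1 := hRz.card_lt_card_subsetSums
    have h2 := hS.card_subsetSums_add_card_subsetSums_sdiff_le hTS
    have h3 := Finset.card_le_univ (subsetSums S)
    obtain ⟨x, hx, hxe⟩ := hRz.exists_escapeCard_ge (Finset.card_pos.1 (by omega))
      (hgen _ Finset.sdiff_subset (by omega)) ⟨0, zero_mem_subsetSums T⟩ (by omega)
    obtain ⟨hxS, hxT⟩ := Finset.mem_sdiff.1 hx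
    refine ⟨insert x T, Finset.insert_subset hxS hTS, ?_, ?_⟩
    · rw [Finset.card_insert_of_notMem hxT, hTc]
    · rw [card_subsetSums_insert hxT, growthBound]
      omega

theorem le_growthBound_of_large {p : ℕ} (hp : 40 ≤ p) (j : ℕ) :
    min p (40 + 20 * j) ≤ growthBound p (7 + j) := by
  induction j with
  | zero =>
    simp only [growthBound]
    omega
  | succ j ih =>
    rw [← add_assoc, growthBound]
    omega

theorem le_growthBound_add {p τ : ℕ} (hτ : p ≤ growthBound p τ) (j : ℕ) :
    2 * p + j * (p + 1) ≤ 2 * growthBound p (τ + j) := by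
  induction j with
  | zero => simpa using hτ
  | succ j ih =>
    rw [← add_assoc, growthBound, add_one_mul]
    generalize j * (p + 1) = q at *
    omega

theorem sq_lt_growthBound {m p s : ℕ} (hm : 0 < m) (hpdef : p = Nat.sqrt (m ^ 2 / 2) + 1)
    (hs1 : p ≤ s) (hs2 : (p - 1) ^ 2 < 9 * s) :
    m ^ 2 + 9 < 9 * (growthBound p (m + 1 - p) + s) := by
  by_cases hmsmall : m < 58
  · have key : ∀ m < 58, 0 < m → m ^ 2 + 9 < 9 * (growthBound (Nat.sqrt (m ^ 2 / 2) + 1)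
        (m + 1 - (Nat.sqrt (m ^ 2 / 2) + 1)) +
        max (Nat.sqrt (m ^ 2 / 2) + 1) (Nat.sqrt (m ^ 2 / 2) ^ 2 / 9 + 1)) := by
      decide +kernel
    have h := key m hmsmall hm
    rw [← hpdef] at h
    have h1 : Nat.sqrt (m ^ 2 / 2) = p - 1 := by omega
    rw [h1] at h
    omega
  push Not at hmsmall
  obtain ⟨q, hq⟩ : ∃ q, q = Nat.sqrt (m ^ 2 / 2) := ⟨_, rfl⟩
  have hq1 : q * q ≤ m ^ 2 / 2 := hq ▸ Nat.sqrt_le _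
  have hq2 : m ^ 2 / 2 < (q + 1) * (q + 1) := hq ▸ Nat.lt_succ_sqrt _
  rw [← hq] at hpdef
  subst hpdef
  have hlow : 2 * (q * q) ≤ m ^ 2 := by omega
  have hupp : m ^ 2 < 2 * ((q + 1) * (q + 1)) := by omega
  have hq41 : 41 ≤ q := by nlinarith
  have hmq : 14 * q ≤ 10 * m := by nlinarith
  obtain ⟨j₀, hj1, hj2⟩ : ∃ j₀, q + 1 ≤ 40 + 20 * j₀ ∧ 20 * j₀ + 20 ≤ q :=
    ⟨(q - 20) / 20, by omega, by omega⟩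
  have hτ : q + 1 ≤ growthBound (q + 1) (7 + j₀) := by
    have := le_growthBound_of_large (p := q + 1) (by omega) j₀
    omega
  obtain ⟨j, hj⟩ : ∃ j, m - q = 7 + j₀ + j := ⟨m - q - (7 + j₀), by omega⟩
  have hgrow := le_growthBound_add hτ j
  rw [← hj] at hgrow
  have hmsub : m + 1 - (q + 1) = m - q := by omega
  rw [hmsub]
  have hj3 : 7 * q ≤ 20 * j + 120 := by omega
  rw [Nat.add_sub_cancel] at hs2
  nlinarith

theorem ZeroSumFree.sq_card_lt_of_closure_eq_top {G : Type*} [AddCommGroup G] [Fintype G]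
    [DecidableEq G] [IsAddCyclic G] {S : Finset G} (hS : ZeroSumFree S)
    (hgen : AddSubgroup.closure (S : Set G) = ⊤)
    (ih : ∀ R ⊂ S, R.card ^ 2 < 9 * (subsetSums R).card) :
    S.card ^ 2 < 9 * (subsetSums S).card := by
  obtain ⟨m, hm⟩ : ∃ m, m = S.card := ⟨_, rfl⟩
  rw [← hm]
  have hlt := hS.card_lt_card_subsetSums
  rcases Nat.eq_zero_or_pos m with rfl | hm0
  · rw [zero_pow two_ne_zero]
    omega
  obtain ⟨p, hp⟩ : ∃ p, p = Nat.sqrt (m ^ 2 / 2) + 1 := ⟨_, rfl⟩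
  have hp1 : m ^ 2 / 2 < p * p := hp ▸ Nat.lt_succ_sqrt _
  have hp2 : (p - 1) * (p - 1) ≤ m ^ 2 / 2 := by
    rw [hp, Nat.add_sub_cancel]
    exact Nat.sqrt_le _
  have hp3 : m ^ 2 < 2 * (p * p) := by omega
  have hpm : p ≤ m := by
    by_contra! h
    have : m * m ≤ (p - 1) * (p - 1) := Nat.mul_self_le_mul_self (by omega)
    have : 0 < m * m := Nat.mul_pos hm0 hm0
    rw [pow_two] at hp2
    omega
  by_cases hcl : ∀ R ⊆ S, p ≤ R.card → AddSubgroup.closure (R : Set G) = ⊤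
  · obtain ⟨T, hTS, hTc, hT⟩ :=
      hS.exists_subset_growthBound_le (by omega) hcl (m + 1 - p) (by omega)
    have hRc : (S \ T).card = p - 1 := by rw [Finset.card_sdiff_of_subset hTS, hTc]; omega
    have hRS : S \ T ⊂ S :=
      Finset.sdiff_ssubset hTS (Finset.card_pos.1 (by omega))
    have h1 := ih _ hRS
    have h2 := (hS.mono (Finset.sdiff_subset (t := T))).card_lt_card_subsetSums
    have h3 := hS.card_subsetSums_add_card_subsetSums_sdiff_le hTS
    rw [hRc] at h1 h2
    have h4 := sq_lt_growthBound hm0 hp (by omega) h1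
    omega
  · push Not at hcl
    obtain ⟨R, hRS, hRc, hR⟩ := hcl
    have hRne : R ≠ S := fun h => hR (h ▸ hgen)
    obtain ⟨x, hxS, hx⟩ : ∃ x ∈ S, x ∉ AddSubgroup.closure (R : Set G) := by
      by_contra! h
      exact hR (top_le_iff.1 (hgen ▸ (AddSubgroup.closure_le _).2 h))
    have h1 := ih R (lt_of_le_of_ne hRS hRne)
    have h2 := two_mul_card_subsetSums_le_of_notMem_closure hRS hxS hx
    nlinarith [Nat.mul_self_le_mul_self hRc]

/-- A zero-sum-free set `S` in a finite cyclic group has more than `|S|² / 9` subset sums. -/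
theorem ZeroSumFree.sq_card_lt {G : Type*} [AddCommGroup G] [Fintype G] [DecidableEq G]
    [IsAddCyclic G] {S : Finset G} (hS : ZeroSumFree S) :
    S.card ^ 2 < 9 * (subsetSums S).card := by
  classical
  induction S using Finset.strongInduction with
  | H S ih =>
    set K := AddSubgroup.closure (S : Set G)
    have : Fintype K := Fintype.ofFinite K
    have hinj : Function.Injective K.subtype := K.subtype_injective
    set S' : Finset K := S.preimage K.subtype hinj.injOn with hS'
    have himg : S'.image K.subtype = S := by
      rw [hS', Finset.image_preimage, Finset.filter_true_of_mem]
      intro x hx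
      exact ⟨⟨x, AddSubgroup.subset_closure hx⟩, rfl⟩
    have hz : ZeroSumFree S' := ZeroSumFree.of_image K.subtype hinj (himg.symm ▸ hS)
    have hgen : AddSubgroup.closure (S' : Set K) = ⊤ := by
      rw [hS', Finset.coe_preimage]
      exact AddSubgroup.closure_closure_coe_preimage
    have hcard : ∀ R : Finset K, (R.image K.subtype).card = R.card := fun R =>
      Finset.card_image_of_injective R hinj
    have hsums : ∀ R : Finset K, (subsetSums (R.image K.subtype)).card = (subsetSums R).card :=
      fun R => by rw [subsetSums_image K.subtype hinj, hcard]
    have main := hz.sq_card_lt_of_closure_eq_top hgen fun R hR => by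
      rw [← hcard R, ← hsums R]
      have hRS : R.image K.subtype ⊂ S := by
        rw [← himg]
        exact (Finset.image_ssubset_image hinj).2 hR
      exact ih _ hRS (hS.mono hRS.subset)
    rwa [← hcard S', ← hsums S', himg] at main

theorem nearestIntDist_le_abs_sub (y : ℝ) (z : ℤ) : nearestIntDist y ≤ |y - z| :=
  round_le y z

/-- If `‖γx‖ > β` for all nonzero `x ∈ D_b*(r)`, then for each `k ≥ 1` fewer than
`3√k` indices `d ∈ {0,…,r}` satisfy `‖k b^d γ‖ ≤ β`. -/
theorem few_good_indices (b : ℕ) (hb : 2 ≤ b) (β : ℝ) (hβ : 0 < β ∧ β ≤ 1 / 2)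
    (r : ℕ) (γ : ℝ)
    (h : ∀ x : ℕ, InDbStarR b r x → x ≠ 0 → β < nearestIntDist (γ * (x : ℝ)))
    (k : ℕ) (hk : 1 ≤ k) :
    (((Finset.range (r + 1)).filter
        (fun d => nearestIntDist ((k : ℝ) * (b : ℝ) ^ d * γ) ≤ β)).card : ℝ)
      < 3 * Real.sqrt k := by
  classical
  set I := (Finset.range (r + 1)).filter
    (fun d => nearestIntDist ((k : ℝ) * (b : ℝ) ^ d * γ) ≤ β) with hI
  have : NeZero k := ⟨by omega⟩
  have hk0 : (0 : ℝ) < k := by exact_mod_cast hk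
  have hbpos : ∀ d, 0 < b ^ d := fun d => Nat.pow_pos (by omega)
  let a : ℕ → ℤ := fun d => round ((k : ℝ) * (b : ℝ) ^ d * γ)
  have hε : ∀ d ∈ I, |(k : ℝ) * (b : ℝ) ^ d * γ - a d| ≤ β := fun d hd =>
    (Finset.mem_filter.1 hd).2
  have hr : ∀ d ∈ I, d ≤ r := fun d hd =>
    Nat.lt_succ_iff.1 (Finset.mem_range.1 (Finset.mem_filter.1 hd).1)
  have hfar : ∀ x : ℕ, InDbStarR b r x → x ≠ 0 → ∀ z : ℤ, k * β < |k * (γ * x) - k * z| := by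
    intro x hx hx0 z
    have h1 := (h x hx hx0).trans_le (nearestIntDist_le_abs_sub _ z)
    rw [← mul_sub, abs_mul, abs_of_pos hk0]
    exact mul_lt_mul_of_pos_left h1 hk0
  -- sums over sets of at most `k` good indices are nonzero modulo `k`
  have hsum : ∀ U ⊆ I, U.Nonempty → U.card ≤ k → ∑ d ∈ U, (a d : ZMod k) ≠ 0 := by
    intro U hU hne hUk h0
    rw [← Int.cast_sum, ZMod.intCast_zmod_eq_zero_iff_dvd] at h0
    obtain ⟨z, hz⟩ := h0
    have hmem : InDbStarR b r (∑ d ∈ U, b ^ d) := by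
      refine Or.inl ⟨fun j => if j ∈ U then 1 else 0, fun i => by dsimp only; split_ifs <;> simp, ?_⟩
      simp only [ite_mul, one_mul, zero_mul]
      rw [← Finset.sum_filter]
      refine Finset.sum_congr ?_ fun _ _ => rfl
      ext d
      rw [Finset.mem_filter, Finset.mem_range]
      exact ⟨fun hd => ⟨Nat.lt_succ_iff.2 (hr d (hU hd)), hd⟩, fun hd => hd.2⟩
    have hpos : 0 < ∑ d ∈ U, b ^ d := Finset.sum_pos (fun d _ => hbpos d) hne
    have h1 := hfar _ hmem hpos.ne' z
    have h2 : (k : ℝ) * (γ * (∑ d ∈ U, b ^ d : ℕ)) - k * z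
        = ∑ d ∈ U, ((k : ℝ) * (b : ℝ) ^ d * γ - a d) := by
      have hz' : ∑ d ∈ U, (a d : ℝ) = k * z := by exact_mod_cast hz
      rw [Finset.sum_sub_distrib, hz', ← Finset.sum_mul, ← Finset.mul_sum]
      push_cast
      ring
    have h3 : |∑ d ∈ U, ((k : ℝ) * (b : ℝ) ^ d * γ - a d)| ≤ U.card * β := by
      refine (Finset.abs_sum_le_sum_abs _ _).trans ?_
      rw [← nsmul_eq_mul]
      exact Finset.sum_le_card_nsmul _ _ _ fun d hd => hε d (hU hd)
    rw [h2] at h1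
    have h4 : (U.card : ℝ) * β ≤ k * β :=
      mul_le_mul_of_nonneg_right (by exact_mod_cast hUk) hβ.1.le
    linarith
  have hne : ∀ c ∈ I, ∀ d ∈ I, c < d → (a c : ZMod k) ≠ a d := by
    intro c hc d hd hcd heq
    have hk2 : 2 ≤ k := by
      by_contra! hk2
      obtain rfl : k = 1 := by omega
      exact hsum {c} (Finset.singleton_subset_iff.2 hc) (Finset.singleton_nonempty c) (by simp)
        (Subsingleton.elim _ _)
    obtain ⟨z, hz⟩ := (ZMod.intCast_eq_intCast_iff_dvd_sub _ _ _).1 heq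
    have hlt : b ^ c < b ^ d := Nat.pow_lt_pow_right (by omega) hcd
    have h1 := hfar (b ^ d - b ^ c) (Or.inr ⟨c, d, hcd, hr d hd, rfl⟩) (Nat.sub_ne_zero_of_lt hlt) z
    have hz' : (a d : ℝ) - a c = k * z := by exact_mod_cast hz
    rw [← hz', Nat.cast_sub hlt.le] at h1
    push_cast at h1
    have h2 : (k : ℝ) * (γ * ((b : ℝ) ^ d - (b : ℝ) ^ c)) - (a d - a c)
        = ((k : ℝ) * (b : ℝ) ^ d * γ - a d) - ((k : ℝ) * (b : ℝ) ^ c * γ - a c) := by ring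
    rw [h2] at h1
    have h3 := abs_sub ((k : ℝ) * (b : ℝ) ^ d * γ - a d) ((k : ℝ) * (b : ℝ) ^ c * γ - a c)
    have h4 : (2 : ℝ) * β ≤ k * β :=
      mul_le_mul_of_nonneg_right (by exact_mod_cast hk2) hβ.1.le
    linarith [hε c hc, hε d hd]
  have hinj : Set.InjOn (fun d => (a d : ZMod k)) I := by
    intro c hc d hd heq
    rcases lt_trichotomy c d with hcd | hcd | hcd
    · exact absurd heq (hne c hc d hd hcd)
    · exact hcd
    · exact absurd heq.symm (hne d hd c hc hcd)
  have hfree : ZeroSumFree (I.image fun d => (a d : ZMod k)) := by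
    intro T hT hTne hT0
    obtain ⟨U, hU, rfl⟩ := Finset.subset_image_iff.1 hT
    have hUinj : Set.InjOn (fun d => (a d : ZMod k)) U := hinj.mono hU
    rw [Finset.sum_image hUinj] at hT0
    refine hsum U hU (Finset.image_nonempty.1 hTne) ?_ hT0
    rw [← Finset.card_image_of_injOn hUinj]
    exact (Finset.card_le_univ _).trans (ZMod.card k).le
  have hlt := hfree.sq_card_lt
  rw [Finset.card_image_of_injOn hinj] at hlt
  have hle : (subsetSums (I.image fun d => (a d : ZMod k))).card ≤ k :=
    (Finset.card_le_univ _).trans (ZMod.card k).le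
  have hlt' : (I.card : ℝ) ^ 2 < 9 * k := by exact_mod_cast hlt.trans_le (by omega)
  refine lt_of_pow_lt_pow_left₀ 2 (by positivity) ?_
  rw [mul_pow, Real.sq_sqrt hk0.le]
  linarith
end

section
/- For every real γ, there exists an effective constant C_b > 0 depending only on b such that for all integers N ≥ 2, there is some n ∈ D_b with 1 ≤ n ≤ N and ‖γn‖ ≤ C_b/(log N)². -/
/-- `n` is a positive integer all of whose base-`b` digits lie in `{0,1}`. -/
def InDb (b n : ℕ) : Prop := n ≠ 0 ∧ ∀ d ∈ Nat.digits b n, d ≤ 1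

open Finset

lemma nearestIntDist_nonneg (y : ℝ) : 0 ≤ nearestIntDist y := abs_nonneg _

lemma nearestIntDist_le_half (y : ℝ) : nearestIntDist y ≤ 1 / 2 := abs_sub_round y

lemma nearestIntDist_le_abs_sub_int (y : ℝ) (k : ℤ) : nearestIntDist y ≤ |y - k| := round_le y k

lemma nearestIntDist_natCast_mul_le (q : ℕ) (y : ℝ) :
    nearestIntDist (q * y) ≤ q * nearestIntDist y := by
  refine (nearestIntDist_le_abs_sub_int _ (q * round y)).trans_eq ?_
  rw [nearestIntDist, ← abs_of_nonneg (Nat.cast_nonneg (α := ℝ) q), ← abs_mul,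
    abs_of_nonneg (Nat.cast_nonneg (α := ℝ) q)]
  push_cast
  ring_nf

lemma nearestIntDist_eq_abs_sub_int {y : ℝ} {k : ℤ} (h : |y - k| < 1 / 2) :
    nearestIntDist y = |y - k| := by
  have : round y = k := by
    rw [round_eq, Int.floor_eq_iff]
    rw [abs_lt] at h
    constructor <;> linarith
  rw [nearestIntDist, this]

lemma nearestIntDist_natCast_mul_eq {b : ℕ} (hb : 0 < b) {y : ℝ}
    (h : nearestIntDist y < 1 / (2 * b)) :
    nearestIntDist (b * y) = b * nearestIntDist y := by
  have hb' : (0 : ℝ) < b := by exact_mod_cast hb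
  have key : |b * y - ((b * round y : ℤ) : ℝ)| = b * nearestIntDist y := by
    rw [nearestIntDist, ← abs_of_pos hb', ← abs_mul, abs_of_pos hb']
    push_cast
    ring_nf
  rw [← key]
  apply nearestIntDist_eq_abs_sub_int
  rw [key]
  rw [lt_div_iff₀ (by positivity)] at h
  linarith

/-- If multiplication by `b` never brings `y` far from the integers, then `y` is very close
to an integer. -/
lemma pow_mul_nearestIntDist_le {b : ℕ} (hb : 0 < b) {y : ℝ} {W : ℕ}
    (h : ∀ i < W, nearestIntDist ((b : ℝ) ^ i * y) < 1 / (2 * b)) :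
    (b : ℝ) ^ W * nearestIntDist y ≤ 1 / 2 := by
  have key : ∀ i ≤ W, nearestIntDist ((b : ℝ) ^ i * y) = (b : ℝ) ^ i * nearestIntDist y := by
    intro i
    induction i with
    | zero => simp
    | succ i ih =>
      intro hi
      rw [pow_succ', mul_assoc, nearestIntDist_natCast_mul_eq hb (h i hi), ih (by omega), mul_assoc]
  rw [← key W le_rfl]
  exact nearestIntDist_le_half _

lemma inv_le_nearestIntDist_div {a M : ℕ} (hM : 0 < M) (h : ¬ M ∣ a) :
    1 / (M : ℝ) ≤ nearestIntDist (a / M) := by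
  have hM' : (0 : ℝ) < M := by exact_mod_cast hM
  rw [nearestIntDist]
  set k := round ((a : ℝ) / M)
  have h1 : (a : ℤ) - k * M ≠ 0 := by
    intro h0
    apply h
    have : (M : ℤ) ∣ a := ⟨k, by linarith⟩
    exact_mod_cast this
  have h2 : (1 : ℝ) ≤ |(((a : ℤ) - k * M : ℤ) : ℝ)| := by
    exact_mod_cast Int.one_le_abs h1
  have h3 : (a : ℝ) / M - k = ((a : ℤ) - k * M : ℤ) / M := by
    push_cast
    field_simp
  rw [h3, abs_div, abs_of_pos hM']
  gcongr

lemma abs_cos_le_of_le_nearestIntDist {y δ : ℝ} (hδ : 0 ≤ δ) (h : δ ≤ nearestIntDist y) :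
    |Real.cos (Real.pi * y)| ≤ Real.cos (Real.pi * δ) := by
  have h1 : |Real.cos (Real.pi * y)| = |Real.cos (Real.pi * nearestIntDist y)| := by
    have : Real.cos (Real.pi * nearestIntDist y) = Real.cos (Real.pi * y - round y * Real.pi) := by
      rw [← Real.cos_abs (_ - _), nearestIntDist, ← abs_of_pos Real.pi_pos, ← abs_mul,
        abs_of_pos Real.pi_pos]
      ring_nf
    rw [this, Real.cos_sub_int_mul_pi, abs_mul, abs_zpow, abs_neg, abs_one, one_zpow, one_mul]
  have h2 := nearestIntDist_le_half y
  have hpi := Real.pi_pos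
  have h3 : 0 ≤ Real.cos (Real.pi * nearestIntDist y) := by
    apply Real.cos_nonneg_of_neg_pi_div_two_le_of_le <;> nlinarith [nearestIntDist_nonneg y]
  rw [h1, abs_of_nonneg h3]
  apply Real.cos_le_cos_of_nonneg_of_le_pi <;> nlinarith

lemma two_mul_nearestIntDist_le_abs_sin (y : ℝ) :
    2 * nearestIntDist y ≤ |Real.sin (Real.pi * y)| := by
  have hpi := Real.pi_pos
  have h0 := nearestIntDist_nonneg y
  have h1 : |Real.sin (Real.pi * y)| = |Real.sin (Real.pi * nearestIntDist y)| := by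
    have e1 : |Real.sin (Real.pi * y)| = |Real.sin (Real.pi * (y - round y))| := by
      have : Real.pi * (y - round y) = Real.pi * y - round y * Real.pi := by ring
      rw [this, Real.sin_sub_int_mul_pi, abs_mul, abs_zpow, abs_neg, abs_one, one_zpow, one_mul]
    rw [e1, nearestIntDist]
    rcases abs_choice (y - round y) with h | h <;> rw [h]
    rw [mul_neg, Real.sin_neg, abs_neg]
  rw [h1]
  refine le_trans ?_ (le_abs_self _)
  have := Real.mul_le_sin (x := Real.pi * nearestIntDist y) (by positivity)
    (by nlinarith [nearestIntDist_le_half y])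
  refine le_trans (le_of_eq ?_) this
  field_simp

/-- The additive character `t ↦ exp (2πit)`. -/
noncomputable def unitExp (t : ℝ) : ℂ := Complex.exp ((2 * Real.pi * t : ℝ) * Complex.I)

lemma unitExp_zero : unitExp 0 = 1 := by simp [unitExp]

lemma unitExp_add (s t : ℝ) : unitExp (s + t) = unitExp s * unitExp t := by
  rw [unitExp, unitExp, unitExp, ← Complex.exp_add]
  push_cast
  ring_nf

lemma norm_unitExp (t : ℝ) : ‖unitExp t‖ = 1 := Complex.norm_exp_ofReal_mul_I _

lemma conj_unitExp (t : ℝ) : starRingEnd ℂ (unitExp t) = unitExp (-t) := by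
  rw [unitExp, unitExp, ← Complex.exp_conj, map_mul, Complex.conj_ofReal, Complex.conj_I]
  push_cast
  ring_nf

lemma unitExp_sum {ι : Type*} (s : Finset ι) (f : ι → ℝ) :
    unitExp (∑ i ∈ s, f i) = ∏ i ∈ s, unitExp (f i) := by
  classical
  induction s using Finset.induction_on with
  | empty => simp [unitExp_zero]
  | insert a s ha ih => rw [sum_insert ha, prod_insert ha, unitExp_add, ih]

lemma unitExp_natCast_mul (l : ℕ) (t : ℝ) : unitExp (l * t) = unitExp t ^ l := by
  rw [unitExp, unitExp, ← Complex.exp_nat_mul]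
  push_cast
  ring_nf

lemma unitExp_natCast (l : ℕ) : unitExp l = 1 := by
  rw [unitExp, Complex.exp_eq_one_iff]
  exact ⟨l, by push_cast; ring⟩

lemma norm_unitExp_sub_one (t : ℝ) : ‖unitExp t - 1‖ = 2 * |Real.sin (Real.pi * t)| := by
  rw [unitExp, mul_comm, Complex.norm_exp_I_mul_ofReal_sub_one, norm_mul, Real.norm_eq_abs,
    Real.norm_eq_abs, abs_two]
  ring_nf

lemma norm_one_add_unitExp (t : ℝ) : ‖1 + unitExp t‖ = 2 * |Real.cos (Real.pi * t)| := by
  have h : unitExp (1 / 2) = -1 := by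
    rw [unitExp, ← Complex.exp_pi_mul_I]
    push_cast
    ring_nf
  have h2 : 1 + unitExp t = -(unitExp (t + 1 / 2) - 1) := by
    rw [unitExp_add, h]
    ring
  rw [h2, norm_neg, norm_unitExp_sub_one, mul_add, mul_one_div, Real.sin_add_pi_div_two]

lemma norm_sum_unitExp_mul_nearestIntDist_le (P : ℕ) (z : ℝ) :
    ‖∑ l ∈ range P, unitExp (l * z)‖ * nearestIntDist z ≤ 1 / 2 := by
  have h1 : (∑ l ∈ range P, unitExp (l * z)) * (unitExp z - 1) = unitExp (P * z) - 1 := by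
    simp_rw [unitExp_natCast_mul]
    exact geom_sum_mul _ _
  have h2 : ‖∑ l ∈ range P, unitExp (l * z)‖ * ‖unitExp z - 1‖ ≤ 2 := by
    rw [← norm_mul, h1]
    refine (norm_sub_le _ _).trans ?_
    rw [norm_unitExp, norm_one]
    norm_num
  rw [norm_unitExp_sub_one] at h2
  nlinarith [two_mul_nearestIntDist_le_abs_sin z,
    norm_nonneg (∑ l ∈ range P, unitExp (l * z)),
    mul_le_mul_of_nonneg_left (two_mul_nearestIntDist_le_abs_sin z)
      (norm_nonneg (∑ l ∈ range P, unitExp (l * z)))]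

lemma dvd_of_sum_unitExp_ne_zero {M n : ℕ} (hM : 0 < M)
    (h : ∑ l ∈ range M, unitExp (l * (n / M)) ≠ 0) : M ∣ n := by
  have hM' : (0 : ℝ) < M := by exact_mod_cast hM
  by_contra hdvd
  have h1 : (∑ l ∈ range M, unitExp (l * (n / M))) * (unitExp (n / M) - 1) = 0 := by
    simp_rw [unitExp_natCast_mul]
    rw [geom_sum_mul, ← unitExp_natCast_mul, mul_div_cancel₀ _ hM'.ne', unitExp_natCast, sub_self]
  have h2 : ‖unitExp (n / M) - 1‖ = 0 := by
    rw [(mul_eq_zero.mp h1).resolve_left h, norm_zero]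
  rw [norm_unitExp_sub_one] at h2
  have h3 := inv_le_nearestIntDist_div hM hdvd
  have h4 := two_mul_nearestIntDist_le_abs_sin ((n : ℝ) / M)
  have : 0 < 1 / (M : ℝ) := by positivity
  linarith

/-- A second-moment argument: if all low frequencies of the random subset sum of
`x 0, …, x (n - 1)` are small, then some subset sum has a large Fejér kernel value. -/
lemma exists_subset_large_exponential_sum (x : ℕ → ℝ) (n : ℕ) (β : ℝ) {P : ℕ} (hP : 0 < P)
    (h : ∀ m : ℕ, 0 < m → m < P →
      ∏ i ∈ range n, |Real.cos (Real.pi * (m * x i))| ≤ 1 / (2 * P)) :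
    ∃ T ⊆ range n, (P : ℝ) / 2 ≤ ‖∑ l ∈ range P, unitExp (l * (∑ i ∈ T, x i + β))‖ ^ 2 := by
  have hP' : (0 : ℝ) < P := by exact_mod_cast hP
  set Φ : ℕ → ℕ → ℂ := fun l k ↦
    unitExp (((l : ℝ) - k) * β) * ∏ i ∈ range n, (1 + unitExp (((l : ℝ) - k) * x i)) with hΦ
  have expand : ∑ T ∈ (range n).powerset,
      ((‖∑ l ∈ range P, unitExp (l * (∑ i ∈ T, x i + β))‖ ^ 2 : ℝ) : ℂ) =
      ∑ l ∈ range P, ∑ k ∈ range P, Φ l k := by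
    have : ∀ T ∈ (range n).powerset,
        ((‖∑ l ∈ range P, unitExp (l * (∑ i ∈ T, x i + β))‖ ^ 2 : ℝ) : ℂ) =
        ∑ l ∈ range P, ∑ k ∈ range P,
          unitExp (((l : ℝ) - k) * β) * ∏ i ∈ T, unitExp (((l : ℝ) - k) * x i) := by
      intro T _
      push_cast
      rw [← Complex.mul_conj', map_sum, sum_mul_sum]
      refine sum_congr rfl fun l _ ↦ sum_congr rfl fun k _ ↦ ?_
      rw [conj_unitExp, ← unitExp_add, ← unitExp_sum, ← mul_sum, ← unitExp_add]
      ring_nf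
    rw [sum_congr rfl this, sum_comm]
    refine sum_congr rfl fun l _ ↦ ?_
    rw [sum_comm]
    refine sum_congr rfl fun k _ ↦ ?_
    simp only [hΦ, prod_one_add, mul_sum]
  have diag : ∀ l, Φ l l = 2 ^ n := by
    intro l
    simp only [hΦ, sub_self, zero_mul, unitExp_zero, one_mul, prod_const, card_range]
    norm_num
  have cosbound : ∀ l ∈ range P, ∀ k ∈ range P, k ≠ l → ‖Φ l k‖ ≤ 2 ^ n / (2 * P) := by
    intro l hl k hk hkl
    rw [mem_range] at hl hk
    simp only [hΦ, norm_mul, norm_unitExp, one_mul, norm_prod, norm_one_add_unitExp,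
      prod_mul_distrib, prod_const, card_range]
    rw [div_eq_mul_one_div]
    refine mul_le_mul_of_nonneg_left ?_ (by positivity)
    rcases lt_or_gt_of_ne hkl with hlt | hlt
    · have := h (l - k) (by omega) (by omega)
      rwa [Nat.cast_sub hlt.le] at this
    · have := h (k - l) (by omega) (by omega)
      rw [Nat.cast_sub hlt.le] at this
      refine le_of_eq_of_le (prod_congr rfl fun i _ ↦ ?_) this
      rw [← Real.cos_neg]
      ring_nf
  have row : ∀ l ∈ range P, (2 : ℝ) ^ n / 2 ≤ (∑ k ∈ range P, Φ l k).re := by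
    intro l hl
    rw [← add_sum_erase _ _ hl, diag, Complex.add_re]
    have h1 : ‖∑ k ∈ (range P).erase l, Φ l k‖ ≤ 2 ^ n / 2 := by
      refine (norm_sum_le_of_le _ fun k hk ↦
        cosbound l hl k (mem_of_mem_erase hk) (ne_of_mem_erase hk)).trans ?_
      rw [sum_const, nsmul_eq_mul]
      calc (((range P).erase l).card : ℝ) * (2 ^ n / (2 * P)) ≤ P * (2 ^ n / (2 * P)) := by
            gcongr
            exact (card_le_card (erase_subset _ _)).trans_eq (card_range P)
        _ = 2 ^ n / 2 := by field_simp
    have h2 := (Complex.abs_re_le_norm (∑ k ∈ (range P).erase l, Φ l k)).trans h1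
    have h3 : ((2 : ℂ) ^ n).re = 2 ^ n := by
      rw [← Complex.ofReal_ofNat, ← Complex.ofReal_pow, Complex.ofReal_re]
    rw [h3]
    linarith [(abs_le.mp h2).1]
  have total : ∑ _T ∈ (range n).powerset, (P : ℝ) / 2 ≤ ∑ T ∈ (range n).powerset,
      ‖∑ l ∈ range P, unitExp (l * (∑ i ∈ T, x i + β))‖ ^ 2 := by
    have h1 := congrArg Complex.re expand
    rw [← Complex.ofReal_sum, Complex.ofReal_re, Complex.re_sum] at h1
    rw [h1, sum_const, card_powerset, card_range, nsmul_eq_mul]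
    refine le_trans (le_of_eq ?_) (sum_le_sum row)
    rw [sum_const, card_range, nsmul_eq_mul]
    push_cast
    ring
  obtain ⟨T, hT, hle⟩ := exists_le_of_sum_le (powerset_nonempty _) total
  exact ⟨T, mem_powerset.mp hT, hle⟩

lemma digits_add_pow_le_one {b n k : ℕ} (hb : 2 ≤ b) (hn : n < b ^ k)
    (h : ∀ d ∈ Nat.digits b n, d ≤ 1) : ∀ d ∈ Nat.digits b (n + b ^ k), d ≤ 1 := by
  have hlen : (Nat.digits b n).length ≤ k := (Nat.digits_length_le_iff hb n).mpr hn
  have key := Nat.digits_append_zeroes_append_digits (b := b) (k := k - (Nat.digits b n).length)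
    (m := 1) (n := n) hb one_pos
  rw [Nat.add_sub_cancel' hlen, mul_one] at key
  rw [← key]
  intro d hd
  rw [Nat.digits_of_lt b 1 one_ne_zero hb] at hd
  simp only [List.mem_append, List.mem_replicate, List.mem_singleton] at hd
  rcases hd with (hd | hd) | hd
  · exact h d hd
  · omega
  · omega

lemma inDb_sum_pow {b : ℕ} (hb : 2 ≤ b) {T : Finset ℕ} (hT : T.Nonempty) :
    InDb b (∑ i ∈ T, b ^ i) := by
  constructor
  · obtain ⟨i, hi⟩ := hT
    have : b ^ i ≤ ∑ i ∈ T, b ^ i := single_le_sum (f := fun i ↦ b ^ i) (by simp) hi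
    have : 0 < b ^ i := by positivity
    omega
  · clear hT
    induction T using Finset.induction_on_max with
    | empty => simp
    | insert a s hs ih =>
      rw [sum_insert fun ha ↦ (hs a ha).false, add_comm]
      exact digits_add_pow_le_one hb (Nat.geomSum_lt hb hs) ih

lemma InDb.pow_mul {b n : ℕ} (hb : 2 ≤ b) (h : InDb b n) (k : ℕ) : InDb b (b ^ k * n) := by
  have hb0 : b ≠ 0 := by omega
  refine ⟨mul_ne_zero (pow_ne_zero _ hb0) h.1, fun d hd ↦ ?_⟩
  rw [Nat.digits_base_pow_mul hb (Nat.pos_of_ne_zero h.1), List.mem_append,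
    List.mem_replicate] at hd
  rcases hd with hd | hd
  · omega
  · exact h.2 d hd

lemma prod_range_mul_le_pow {f : ℕ → ℝ} {ρ : ℝ} (hf0 : ∀ i, 0 ≤ f i) (hf1 : ∀ i, f i ≤ 1)
    {R W : ℕ} (h : ∀ j < R, ∃ i < W, f (j * W + i) ≤ ρ) :
    ∏ i ∈ range (R * W), f i ≤ ρ ^ R := by
  induction R with
  | zero => simp
  | succ R ih =>
    obtain ⟨i, hi, hρ⟩ := h R (by omega)
    have hblock : ∏ i ∈ range W, f (R * W + i) ≤ ρ := by
      rw [← mul_prod_erase _ _ (mem_range.mpr hi)]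
      refine (mul_le_of_le_one_right (hf0 _) ?_).trans hρ
      exact prod_le_one (fun _ _ ↦ hf0 _) fun _ _ ↦ hf1 _
    rw [add_mul, one_mul, prod_range_add, pow_succ]
    exact mul_le_mul (ih fun j hj ↦ h j (by omega)) hblock (prod_nonneg fun _ _ ↦ hf0 _)
      (pow_nonneg ((hf0 _).trans hρ) _)

/-- If every low frequency is far from the integers somewhere in each of `R` consecutive blocks of
`W` powers of `b`, then a suitable `n ∈ D_b` has a large Fejér kernel value at `nγ`. -/
lemma exists_inDb_large_exponential_sum {b : ℕ} (hb : 2 ≤ b) (γ : ℝ) {P R W : ℕ} (hP : 0 < P)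
    (hρ : Real.cos (Real.pi * (1 / (2 * b))) ^ R ≤ 1 / (2 * P))
    (h : ∀ m : ℕ, 0 < m → m < P → ∀ j < R, ∃ i < W,
      1 / (2 * (b : ℝ)) ≤ nearestIntDist (m * ((b : ℝ) ^ (j * W + i) * γ))) :
    ∃ n : ℕ, InDb b n ∧ n < b ^ (R * W + 1) ∧
      (P : ℝ) / 2 ≤ ‖∑ l ∈ range P, unitExp (l * (n * γ))‖ ^ 2 := by
  obtain ⟨T, hT, hle⟩ := exists_subset_large_exponential_sum (fun i ↦ (b : ℝ) ^ i * γ) (R * W)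
    ((b : ℝ) ^ (R * W) * γ) hP (by
      intro m hm hmP
      refine (prod_range_mul_le_pow (fun _ ↦ abs_nonneg _) (fun _ ↦ Real.abs_cos_le_one _)
        fun j hj ↦ ?_).trans hρ
      obtain ⟨i, hi, hbig⟩ := h m hm hmP j hj
      exact ⟨i, hi, abs_cos_le_of_le_nearestIntDist (by positivity) hbig⟩)
  have hnot : R * W ∉ T := fun hmem ↦ by simpa using hT hmem
  refine ⟨∑ i ∈ insert (R * W) T, b ^ i, inDb_sum_pow hb (insert_nonempty _ _),
    Nat.geomSum_lt hb ?_, ?_⟩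
  · intro k hk
    rcases mem_insert.mp hk with rfl | hk
    · omega
    · have := mem_range.mp (hT hk)
      omega
  · convert hle using 8
    rw [sum_insert hnot, ← sum_mul]
    push_cast
    ring

lemma exists_coprime_factor {b : ℕ} (L : ℕ) {M : ℕ} (hM : 0 < M) (hML : M ≤ 2 ^ L) :
    ∃ M₁ M₂ : ℕ, M = M₁ * M₂ ∧ M₁.Coprime b ∧ M₂ ∣ b ^ L := by
  induction L generalizing M with
  | zero =>
    have : M = 1 := by simp at hML; omega
    exact ⟨1, 1, by simp [this]⟩
  | succ L ih =>
    by_cases hg : M.Coprime b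
    · exact ⟨M, 1, (mul_one M).symm, hg, one_dvd _⟩
    obtain ⟨M', hM'⟩ := Nat.gcd_dvd_left M b
    have hg0 : 0 < M.gcd b := Nat.gcd_pos_of_pos_left _ hM
    have hg1 : M.gcd b ≠ 1 := hg
    have hM'0 : 0 < M' := Nat.pos_of_ne_zero fun h0 ↦ by simp [h0] at hM'; omega
    obtain ⟨M₁, M₂, h1, h2, h3⟩ := ih hM'0 (by
      have h2 : 2 * M' ≤ M.gcd b * M' := Nat.mul_le_mul_right _ (by omega)
      rw [pow_succ] at hML
      omega)
    refine ⟨M₁, M.gcd b * M₂, ?_, h2, ?_⟩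
    · conv_lhs => rw [hM', h1]
      ring
    · rw [pow_succ']
      exact mul_dvd_mul (Nat.gcd_dvd_right M b) h3

/-- Every `M` has a multiple in `D_b` with polylogarithmically many digits. -/
lemma exists_inDb_multiple {b : ℕ} (hb : 2 ≤ b) {L R M : ℕ} (hM : 0 < M) (hML : M ≤ 2 ^ L)
    (hρ : Real.cos (Real.pi * (1 / (2 * b))) ^ R ≤ 1 / (2 * 2 ^ L)) :
    ∃ n : ℕ, InDb b n ∧ n < b ^ (R * L + 1 + L) ∧ M ∣ n := by
  have hb0 : 0 < b := by omega
  obtain ⟨M₁, M₂, rfl, hcop, hdvd⟩ := exists_coprime_factor (b := b) L hM hML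
  have hM₁ : 0 < M₁ := Nat.pos_of_mul_pos_right hM
  have hM₁' : (0 : ℝ) < M₁ := by exact_mod_cast hM₁
  have hM₂ : 0 < M₂ := Nat.pos_of_mul_pos_left hM
  have hM₁L : (M₁ : ℝ) ≤ 2 ^ L := by exact_mod_cast (Nat.le_mul_of_pos_right M₁ hM₂).trans hML
  obtain ⟨n, hn, hlt, hle⟩ := exists_inDb_large_exponential_sum (W := L) hb (1 / (M₁ : ℝ)) hM₁
    (hρ.trans (by gcongr)) (by
      intro m hm hmM j _
      by_contra! hsmall
      have hnd : ¬ M₁ ∣ m * b ^ (j * L) := fun hd ↦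
        (Nat.le_of_dvd hm ((hcop.pow_right _).dvd_of_dvd_mul_right hd)).not_gt hmM
      have h1 := inv_le_nearestIntDist_div hM₁ hnd
      have h2 := pow_mul_nearestIntDist_le hb0
        (y := ((m * b ^ (j * L) : ℕ) : ℝ) / M₁) (W := L) (by
          intro i hi
          refine lt_of_eq_of_lt (congrArg nearestIntDist ?_) (hsmall i hi)
          push_cast
          ring)
      have h3 : (2 : ℝ) ^ L * (1 / 2 ^ L) ≤
          (b : ℝ) ^ L * nearestIntDist (((m * b ^ (j * L) : ℕ) : ℝ) / M₁) := by
        have hb' : (2 : ℝ) ≤ b := by exact_mod_cast hb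
        gcongr
        exact le_trans (by gcongr) h1
      have h4 : (2 : ℝ) ^ L * (1 / 2 ^ L) = 1 := by field_simp
      linarith)
  have hM₁n : M₁ ∣ n := by
    apply dvd_of_sum_unitExp_ne_zero hM₁
    intro h0
    simp only [mul_one_div] at hle
    rw [h0, norm_zero] at hle
    linarith
  refine ⟨b ^ L * n, hn.pow_mul hb L, ?_, ?_⟩
  · rw [pow_add, mul_comm (b ^ L)]
    gcongr
  · rw [mul_comm]
    exact mul_dvd_mul hdvd hM₁n

lemma exists_inDb_sq_nearestIntDist_le {b : ℕ} (hb : 2 ≤ b) (γ : ℝ) {L R : ℕ}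
    (hρ : Real.cos (Real.pi * (1 / (2 * b))) ^ R ≤ 1 / (2 * 2 ^ L)) :
    ∃ n : ℕ, InDb b n ∧ n < b ^ (R * (R * L + 1 + 2 * L) + 1) ∧
      nearestIntDist (γ * n) ^ 2 ≤ 1 / 2 ^ L := by
  have hb0 : 0 < b := by omega
  have hb' : (2 : ℝ) ≤ b := by exact_mod_cast hb
  set W := R * L + 1 + 2 * L with hW
  by_cases hlarge : ∀ m : ℕ, 0 < m → m < 2 ^ L → ∀ j < R, ∃ i < W,
      1 / (2 * (b : ℝ)) ≤ nearestIntDist (m * ((b : ℝ) ^ (j * W + i) * γ))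
  · obtain ⟨n, hn, hlt, hle⟩ := exists_inDb_large_exponential_sum hb γ (P := 2 ^ L) (by positivity)
      (by exact_mod_cast hρ) hlarge
    refine ⟨n, hn, hlt, ?_⟩
    rw [mul_comm]
    have h1 := norm_sum_unitExp_mul_nearestIntDist_le (2 ^ L) (n * γ)
    set d := nearestIntDist (n * γ)
    set s := ‖∑ l ∈ range (2 ^ L), unitExp (l * (n * γ))‖
    have hd : 0 ≤ d := nearestIntDist_nonneg _
    have hs : 0 ≤ s := norm_nonneg _
    push_cast at hle
    have h2 : (s * d) ^ 2 ≤ (1 / 2) ^ 2 := by gcongr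
    rw [mul_pow] at h2
    have h3 := mul_le_mul_of_nonneg_right hle (sq_nonneg d)
    rw [le_div_iff₀ (by positivity)]
    linarith
  · push Not at hlarge
    obtain ⟨m, hm, hmP, j, hj, hsmall⟩ := hlarge
    obtain ⟨n, hn, hlt, q, rfl⟩ := exists_inDb_multiple hb hm hmP.le hρ
    refine ⟨b ^ (j * W) * (m * q), hn.pow_mul hb _, ?_, ?_⟩
    · have hexp : j * W + (R * L + 1 + L) ≤ R * W + 1 := by
        have : (j + 1) * W ≤ R * W := Nat.mul_le_mul_right _ hj
        rw [add_mul] at this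
        omega
      calc b ^ (j * W) * (m * q) < b ^ (j * W) * b ^ (R * L + 1 + L) := by gcongr
        _ = b ^ (j * W + (R * L + 1 + L)) := (pow_add _ _ _).symm
        _ ≤ b ^ (R * W + 1) := Nat.pow_le_pow_right hb0 hexp
    · set y : ℝ := m * ((b : ℝ) ^ (j * W) * γ) with hy
      have h1 := pow_mul_nearestIntDist_le hb0 (y := y) (W := W) (by
        intro i hi
        refine lt_of_eq_of_lt (congrArg nearestIntDist ?_) (hsmall i hi)
        rw [hy]
        ring)
      have h2 : γ * ((b ^ (j * W) * (m * q) : ℕ) : ℝ) = q * y := by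
        rw [hy]
        push_cast
        ring
      have hq : (q : ℝ) ≤ (b : ℝ) ^ (R * L + 1 + L) := by
        exact_mod_cast (Nat.le_mul_of_pos_left q hm).trans hlt.le
      have h3 := nearestIntDist_natCast_mul_le q y
      have hy0 := nearestIntDist_nonneg y
      have h4 : (b : ℝ) ^ L * nearestIntDist (q * y) ≤ 1 / 2 := by
        calc (b : ℝ) ^ L * nearestIntDist (q * y)
            ≤ (b : ℝ) ^ L * ((b : ℝ) ^ (R * L + 1 + L) * nearestIntDist y) := by
              gcongr
              exact h3.trans (by gcongr)
          _ = (b : ℝ) ^ W * nearestIntDist y := by rw [hW]; ring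
          _ ≤ 1 / 2 := h1
      have h5 : (2 : ℝ) ^ L * nearestIntDist (q * y) ≤ 1 / 2 :=
        le_trans (by gcongr; exact nearestIntDist_nonneg _) h4
      rw [h2, le_div_iff₀ (by positivity)]
      have h6 := nearestIntDist_nonneg (q * y)
      have h7 := nearestIntDist_le_half (q * y)
      nlinarith [mul_le_mul_of_nonneg_right h5 h6]

lemma exists_pow_cos_le_half {b : ℕ} (hb : 2 ≤ b) :
    ∃ c : ℕ, 0 < c ∧ ∀ L : ℕ,
      Real.cos (Real.pi * (1 / (2 * b))) ^ (c * (L + 1)) ≤ 1 / (2 * 2 ^ L) := by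
  have hb' : (2 : ℝ) ≤ b := by exact_mod_cast hb
  have hpi := Real.pi_pos
  have hx0 : 0 < 1 / (2 * (b : ℝ)) := by positivity
  have hx1 : 1 / (2 * (b : ℝ)) ≤ 1 / 2 := by gcongr; linarith
  have h0 : 0 ≤ Real.cos (Real.pi * (1 / (2 * b))) := by
    apply Real.cos_nonneg_of_neg_pi_div_two_le_of_le <;> nlinarith
  have h1 : Real.cos (Real.pi * (1 / (2 * b))) < 1 := by
    refine lt_of_lt_of_eq ?_ Real.cos_zero
    apply Real.cos_lt_cos_of_nonneg_of_le_pi le_rfl <;> nlinarith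
  obtain ⟨c, hc⟩ := exists_pow_lt_of_lt_one (by norm_num : (0 : ℝ) < 1 / 2) h1
  refine ⟨c, Nat.pos_of_ne_zero ?_, fun L ↦ ?_⟩
  · rintro rfl
    norm_num at hc
  · rw [pow_mul]
    calc (Real.cos (Real.pi * (1 / (2 * b))) ^ c) ^ (L + 1) ≤ (1 / 2) ^ (L + 1) := by gcongr
      _ = 1 / (2 * 2 ^ L) := by rw [div_pow, one_pow, pow_succ']

lemma exists_bound_pow_div_two_pow (k : ℕ) :
    ∃ K : ℝ, 0 < K ∧ ∀ L : ℕ, ((L : ℝ) + 2) ^ k ≤ K * 2 ^ L := by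
  obtain ⟨K, hK⟩ := (tendsto_pow_const_div_const_pow_of_one_lt k
    (one_lt_two : (1 : ℝ) < 2)).bddAbove_range
  refine ⟨4 * |K| + 1, by positivity, fun L ↦ ?_⟩
  have h := hK (Set.mem_range_self (L + 2))
  simp only [div_le_iff₀ (by positivity : (0 : ℝ) < 2 ^ (L + 2))] at h
  push_cast at h
  rw [pow_add] at h
  have : (0 : ℝ) < 2 ^ L := by positivity
  nlinarith [le_abs_self K]

/-- Main theorem: approximation with denominators in `D_b` of quality `C_b/(log N)²`. -/
theorem main_approximation (b : ℕ) (hb : 2 ≤ b) :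
    ∃ C : ℝ, 0 < C ∧ ∀ γ : ℝ, ∀ N : ℕ, 2 ≤ N →
      ∃ n : ℕ, InDb b n ∧ 1 ≤ n ∧ n ≤ N ∧
        nearestIntDist (γ * (n : ℝ)) ≤ C / (Real.log N) ^ 2 := by
  obtain ⟨c, hc, hρ⟩ := exists_pow_cos_le_half hb
  obtain ⟨K, hK, hKL⟩ := exists_bound_pow_div_two_pow 12
  set E := 4 * c ^ 2 with hE
  have hE0 : 0 < E := by positivity
  have hb' : (1 : ℝ) < b := by exact_mod_cast hb
  have hlogb : 0 < Real.log b := Real.log_pos hb'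
  set A : ℝ := E * Real.log b with hA
  have hA0 : 0 < A := by positivity
  refine ⟨(K + 1) * A ^ 2, by positivity, fun γ N hN ↦ ?_⟩
  have hN' : (1 : ℝ) < N := by exact_mod_cast hN
  have hlogN : 0 < Real.log N := Real.log_pos hN'
  have hlog : ∀ k : ℕ, N < b ^ (E * k) → Real.log N ≤ A * k := by
    intro k hk
    have h1 : (N : ℝ) ≤ (b : ℝ) ^ (E * k) := by exact_mod_cast hk.le
    have h2 := Real.log_le_log (by linarith) h1
    rw [Real.log_pow] at h2
    refine h2.trans_eq ?_
    rw [hA]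
    push_cast
    ring
  have hex : ∃ L : ℕ, N < b ^ (E * (L + 1) ^ 3) := by
    refine ⟨N, (Nat.lt_pow_self hb).trans_le (Nat.pow_le_pow_right (by omega) ?_)⟩
    calc N ≤ 1 * (N + 1) ^ 1 := by simp
      _ ≤ E * (N + 1) ^ 3 := by gcongr <;> omega
  classical
  have hspec := Nat.find_spec hex
  have hmin := fun m ↦ Nat.find_min hex (m := m)
  rcases hfind : Nat.find hex with _ | L
  · rw [hfind] at hspec
    have h1 := hlog 1 (by simpa using hspec)
    refine ⟨1, by simpa using inDb_sum_pow hb (singleton_nonempty 0), le_rfl, by omega, ?_⟩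
    rw [le_div_iff₀ (by positivity)]
    have h2 := nearestIntDist_le_half (γ * (1 : ℕ))
    have h3 : Real.log N ^ 2 ≤ A ^ 2 := by
      gcongr
      simpa using h1
    calc nearestIntDist (γ * (1 : ℕ)) * Real.log N ^ 2 ≤ 1 * A ^ 2 := by
          gcongr
          exact h2.trans (by norm_num)
      _ ≤ (K + 1) * A ^ 2 := by
          gcongr
          linarith
  · rw [hfind] at hspec hmin
    have hge : b ^ (E * (L + 1) ^ 3) ≤ N := not_lt.mp (hmin L (by omega))
    have h1 := hlog ((L + 2) ^ 3) hspec
    obtain ⟨n, hn, hlt, hd⟩ := exists_inDb_sq_nearestIntDist_le hb γ (hρ L)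
    refine ⟨n, hn, Nat.pos_of_ne_zero hn.1, (hlt.le.trans ?_).trans hge, ?_⟩
    · refine Nat.pow_le_pow_right (by omega) ?_
      have e1 : c * (L + 1) * (c * (L + 1) * L + 1 + 2 * L) + 1 ≤
          c * (L + 1) * (c * (L + 1) * (L + 1) + 2 * (c * (L + 1) * (L + 1))) +
            c * (L + 1) * (c * (L + 1) * (L + 1)) := by
        have h2 : 1 ≤ c * (L + 1) := Nat.mul_pos hc (by omega)
        have h3 : L + 1 ≤ c * (L + 1) * (L + 1) := Nat.le_mul_of_pos_left _ h2
        have h4 : 1 ≤ c * (L + 1) * (c * (L + 1) * (L + 1)) := Nat.mul_pos h2 (by omega)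
        refine Nat.add_le_add (Nat.mul_le_mul_left _ ?_) h4
        nlinarith
      refine e1.trans_eq ?_
      rw [hE]
      ring
    · rw [le_div_iff₀ (by positivity)]
      refine le_of_sq_le_sq ?_ (by positivity)
      push_cast at h1
      calc (nearestIntDist (γ * n) * Real.log N ^ 2) ^ 2
          = nearestIntDist (γ * n) ^ 2 * Real.log N ^ 4 := by ring
        _ ≤ 1 / 2 ^ L * (A * (L + 2) ^ 3) ^ 4 := by gcongr
        _ = 1 / 2 ^ L * A ^ 4 * (L + 2) ^ 12 := by ring
        _ ≤ 1 / 2 ^ L * A ^ 4 * (K * 2 ^ L) := by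
            gcongr
            exact hKL L
        _ = K * A ^ 4 := by field_simp
        _ ≤ (K + 1) ^ 2 * A ^ 4 := by
            gcongr
            nlinarith
        _ = ((K + 1) * A ^ 2) ^ 2 := by ring
end
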